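/- arXiv:2001.01419 — 3 statements merged into one kernel-verified Lean document; each statement's English description precedes it below -/
import Mathlib

section
/- Let G be a connected simple graph of order n and k a positive integer. If G has an RMC_k-coloring, then 1 ≤ k ≤ ⌊n/2⌋. -/
open SimpleGraph

/-- A walk is monochromatic with color `col` under the edge-coloring `c`. -/
def SimpleGraph.Walk.IsMonochromatic {V : Type*} {G : SimpleGraph V} (c : Sym2 V → ℕ)
    {u v : V} (W : G.Walk u v) (col : ℕ) : Prop :=
  ∀ e ∈ W.edges, c e = col

/-- `c` is a rainbow monochromatic `k`-edge-connection coloring of `G`: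
every two distinct vertices are joined by `k` pairwise edge-disjoint monochromatic
paths with pairwise distinct colors. -/
def SimpleGraph.IsRMCColoring {V : Type*} (G : SimpleGraph V) (k : ℕ) (c : Sym2 V → ℕ) : Prop :=
  ∀ u v : V, u ≠ v → ∃ (P : Fin k → G.Walk u v) (col : Fin k → ℕ),
    (∀ i, (P i).IsPath) ∧
    (∀ i, (P i).IsMonochromatic c (col i)) ∧
    (∀ i j, i ≠ j → ∀ e, e ∈ (P i).edges → e ∉ (P j).edges) ∧
    Function.Injective col

/-- The number of colors used by `c` on the edges of `G`. -/
noncomputable def SimpleGraph.colorsUsed {V : Type*} (G : SimpleGraph V) (c : Sym2 V → ℕ) : ℕ :=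
  (c '' G.edgeSet).ncard

/-- `rmc_k(G)`: the maximum number of colors in an RMC_k-coloring of `G` (0 if none exists). -/
noncomputable def SimpleGraph.rmc {V : Type*} (G : SimpleGraph V) (k : ℕ) : ℕ :=
  sSup {t | ∃ c : Sym2 V → ℕ, G.IsRMCColoring k c ∧ G.colorsUsed c = t}

/-- `τ(G) ≥ k`: `G` has `k` pairwise edge-disjoint spanning trees
(Nash-Williams–Tutte). -/
def SimpleGraph.TauGE {V : Type*} (G : SimpleGraph V) (k : ℕ) : Prop :=
  ∃ T : Fin k → SimpleGraph V, (∀ i, T i ≤ G) ∧ (∀ i, (T i).IsTree) ∧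
    ∀ i j, i ≠ j → Disjoint (T i).edgeSet (T j).edgeSet


/-- The spanning subgraph of `G` formed by the edges of color `col`. -/
def SimpleGraph.colorClass {V : Type*} (G : SimpleGraph V) (c : Sym2 V → ℕ) (col : ℕ) :
    SimpleGraph V where
  Adj a b := G.Adj a b ∧ c s(a, b) = col
  symm := ⟨fun _ _ h => ⟨h.1.symm, Sym2.eq_swap ▸ h.2⟩⟩
  loopless := ⟨fun _ h => h.1.ne rfl⟩

theorem SimpleGraph.Walk.IsMonochromatic.reachable_colorClass {V : Type*} {G : SimpleGraph V}
    {c : Sym2 V → ℕ} {col : ℕ} {u v : V} {W : G.Walk u v} (hW : W.IsMonochromatic c col) :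
    (G.colorClass c col).Reachable u v := by
  refine ⟨W.transfer _ fun e he => ?_⟩
  have hG := W.edges_subset_edgeSet he
  have hc := hW e he
  induction e with
  | h a b => exact ⟨hG, hc⟩

theorem SimpleGraph.Reachable.exists_adj_dist_lt {V : Type*} {H : SimpleGraph V} {u v : V}
    (h : H.Reachable v u) (hne : v ≠ u) : ∃ p, H.Adj v p ∧ H.dist p u < H.dist v u := by
  obtain ⟨W, hW⟩ := h.exists_walk_length_eq_dist
  cases W with
  | nil => exact absurd rfl hne
  | cons hadj q =>
    refine ⟨_, hadj, ?_⟩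
    have := H.dist_le q
    rw [Walk.length_cons] at hW
    omega

/-- In an RMC_k-coloring, each vertex other than `u` can be charged with `k` private edges: the
first edges of shortest monochromatic paths to `u` in `k` different colors. -/
theorem SimpleGraph.IsRMCColoring.mul_card_sub_one_le {V : Type*} [Fintype V]
    {G : SimpleGraph V} [Fintype G.edgeSet] {k : ℕ} {c : Sym2 V → ℕ} (h : G.IsRMCColoring k c)
    (u : V) : (Fintype.card V - 1) * k ≤ G.edgeFinset.card := by
  classical
  have hcol (v : {v : V // v ≠ u}) : ∃ col : Fin k → ℕ, Function.Injective col ∧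
      ∀ i, (G.colorClass c (col i)).Reachable v u := by
    obtain ⟨P, col, -, hP, -, hinj⟩ := h v u v.2
    exact ⟨col, hinj, fun i => (hP i).reachable_colorClass⟩
  choose col hinj hreach using hcol
  choose p hadj hdist using fun v i => (hreach v i).exists_adj_dist_lt v.2
  let f : {v : V // v ≠ u} × Fin k → G.edgeSet := fun x => ⟨s(x.1.1, p x.1 x.2), (hadj x.1 x.2).1⟩
  have hf : Function.Injective f := by
    rintro ⟨v, i⟩ ⟨w, j⟩ hvw
    have he : s(v.1, p v i) = s(w.1, p w j) := congrArg Subtype.val hvw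
    have hc : col v i = col w j := by
      rw [← (hadj v i).2, ← (hadj w j).2, he]
    have hval : v = w := by
      rcases Sym2.eq_iff.mp he with ⟨h1, -⟩ | ⟨h1, h2⟩
      · exact Subtype.ext h1
      · have hv := hdist v i
        have hw := hdist w j
        rw [h2, hc] at hv
        rw [← h1] at hw
        exact absurd hv hw.asymm
    subst hval
    rw [hinj v hc]
  have := Fintype.card_le_of_injective f hf
  rwa [Fintype.card_prod, Fintype.card_fin, Fintype.card_subtype_compl,
    Fintype.card_subtype_eq, ← SimpleGraph.edgeFinset_card] at this

/-- If a connected simple graph of order `n ≥ 2` has an RMC_k-coloring,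
then `1 ≤ k ≤ ⌊n/2⌋`. -/
theorem k_le_half_card {V : Type*} [Fintype V] [Nontrivial V] (G : SimpleGraph V) (k : ℕ)
    (hG : G.Connected) (hk : 1 ≤ k) (h : ∃ c : Sym2 V → ℕ, G.IsRMCColoring k c) :
    1 ≤ k ∧ k ≤ Fintype.card V / 2 := by
  classical
  refine ⟨hk, ?_⟩
  obtain ⟨c, hc⟩ := h
  obtain ⟨u⟩ := hG.nonempty
  have hle := (hc.mul_card_sub_one_le u).trans G.card_edgeFinset_le_card_choose_two
  have hcard := Fintype.one_lt_card (α := V)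
  rw [Nat.choose_two_right, Nat.le_div_iff_mul_le two_pos] at hle
  rw [Nat.le_div_iff_mul_le two_pos]
  refine Nat.le_of_mul_le_mul_left (c := Fintype.card V - 1) ?_ (by omega)
  rwa [← mul_assoc, mul_comm _ (Fintype.card V)]
end

section
/- Let G be a simple graph on n vertices with m edges, let k be a positive integer with τ(G) ≥ k, and let s be a nonnegative integer. If G is not (s+1)-connected (i.e., the vertex connectivity of G is at most s), then rmc_k(G) ≤ m − k(n − 2) + s. -/
open SimpleGraph

/-- `G` is `k`-vertex-connected: it has more than `k` vertices and removing
fewer than `k` vertices leaves a connected graph. -/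
def SimpleGraph.IsKConnected {V : Type*} [Fintype V] (G : SimpleGraph V) (k : ℕ) : Prop :=
  k < Fintype.card V ∧ ∀ U : Set V, U.ncard < k → (G.induce (Uᶜ : Set V)).Connected

section Counting

variable {V ι : Type*} [DecidableEq V]

/-- Double counting of the pairs of `E` that are contained in members of a family of sets. -/
lemma mul_card_le_sum_card_pairs (J : Finset ι) (T : ι → Finset V) (E : Finset (V × V)) (r : ℝ)
    (h : ∀ p ∈ E, r ≤ (J.filter fun j => p.1 ∈ T j ∧ p.2 ∈ T j).card) :
    r * E.card ≤ ∑ j ∈ J, ((E.filter fun p => p.1 ∈ T j ∧ p.2 ∈ T j).card : ℝ) := by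
  have key := Finset.sum_card_bipartiteAbove_eq_sum_card_bipartiteBelow (s := J) (t := E)
    (fun j p => p.1 ∈ T j ∧ p.2 ∈ T j)
  simp only [Finset.bipartiteAbove, Finset.bipartiteBelow] at key
  have key' : ∑ j ∈ J, ((E.filter fun p => p.1 ∈ T j ∧ p.2 ∈ T j).card : ℝ) =
      ∑ p ∈ E, ((J.filter fun j => p.1 ∈ T j ∧ p.2 ∈ T j).card : ℝ) := by
    exact_mod_cast key
  rw [key', mul_comm, ← nsmul_eq_mul]
  exact Finset.card_nsmul_le_sum _ _ _ h

lemma mul_card_mul_card_le_sum (J : Finset ι) (T : ι → Finset V) (X Y : Finset V) (r : ℝ)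
    (h : ∀ x ∈ X, ∀ y ∈ Y, r ≤ (J.filter fun j => x ∈ T j ∧ y ∈ T j).card) :
    r * (X.card * Y.card) ≤ ∑ j ∈ J, ((T j ∩ X).card * (T j ∩ Y).card : ℝ) := by
  have := mul_card_le_sum_card_pairs J T (X ×ˢ Y) r (by
    rintro ⟨x, y⟩ hp
    exact h x (Finset.mem_product.1 hp).1 y (Finset.mem_product.1 hp).2)
  rw [Finset.card_product] at this
  push_cast at this
  refine this.trans (le_of_eq (Finset.sum_congr rfl fun j _ => ?_))
  rw [← Nat.cast_mul, ← Finset.card_product]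
  congr 2
  ext ⟨x, y⟩
  simp only [Finset.mem_filter, Finset.mem_product, Finset.mem_inter]
  tauto

lemma mul_card_mul_card_sub_one_le_sum (J : Finset ι) (T : ι → Finset V) (X : Finset V) (r : ℝ)
    (h : ∀ x ∈ X, ∀ y ∈ X, x ≠ y → r ≤ (J.filter fun j => x ∈ T j ∧ y ∈ T j).card) :
    r * (X.card * (X.card - 1)) ≤
      ∑ j ∈ J, ((T j ∩ X).card * ((T j ∩ X).card - 1) : ℝ) := by
  have hoff : ∀ S : Finset V, (S.offDiag.card : ℝ) = S.card * (S.card - 1) := by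
    intro S
    rw [Finset.offDiag_card, Nat.cast_sub (Nat.le_mul_self _)]
    push_cast
    ring
  have := mul_card_le_sum_card_pairs J T X.offDiag r (by
    rintro ⟨x, y⟩ hp
    obtain ⟨h1, h2, h3⟩ := Finset.mem_offDiag.1 hp
    exact h x h1 y h2 h3)
  rw [hoff] at this
  refine this.trans (le_of_eq (Finset.sum_congr rfl fun j _ => ?_))
  rw [← hoff]
  congr 2
  ext ⟨x, y⟩
  simp only [Finset.mem_filter, Finset.mem_offDiag, Finset.mem_inter]
  tauto

/-- Among the subsets of size `t ≥ 3` of an `N`-set, the ratio of the number of pairs to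
`t - 2` is largest for `t = N`. -/
lemma sub_two_mul_pairs_le {t N : ℕ} (ht : 3 ≤ t) (hN : t ≤ N) :
    ((N : ℝ) - 2) * (t * (t - 1)) ≤ (t - 2) * (N * (N - 1)) := by
  obtain rfl | hlt := hN.eq_or_lt
  · linarith
  have h1 : (3 : ℝ) ≤ t := by exact_mod_cast ht
  have h2 : (t : ℝ) + 1 ≤ N := by exact_mod_cast hlt
  nlinarith [mul_nonneg (by linarith : (0 : ℝ) ≤ N - t)
    (by nlinarith : (0 : ℝ) ≤ (N - 2) * (t - 2) - 2)]

/-- A family of sets of size at least three covering every pair at least `r` times. -/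
lemma mul_card_sub_two_le_sum [Fintype V] (J : Finset ι) (T : ι → Finset V) (r : ℝ)
    (hn : 3 ≤ Fintype.card V) (h3 : ∀ j ∈ J, 3 ≤ (T j).card)
    (h : ∀ x y, x ≠ y → r ≤ (J.filter fun j => x ∈ T j ∧ y ∈ T j).card) :
    r * (Fintype.card V - 2) ≤ ∑ j ∈ J, ((T j).card - 2 : ℝ) := by
  have h1 := mul_card_mul_card_sub_one_le_sum J T Finset.univ r fun x _ y _ => h x y
  simp only [Finset.inter_univ, Finset.card_univ] at h1
  have h2 : ∑ j ∈ J, ((Fintype.card V : ℝ) - 2) * ((T j).card * ((T j).card - 1)) ≤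
      ∑ j ∈ J, ((T j).card - 2 : ℝ) * (Fintype.card V * (Fintype.card V - 1)) :=
    Finset.sum_le_sum fun j hj => sub_two_mul_pairs_le (h3 j hj) (Finset.card_le_univ _)
  rw [← Finset.mul_sum, ← Finset.sum_mul] at h2
  have hn' : (3 : ℝ) ≤ Fintype.card V := by exact_mod_cast hn
  have hpos : (0 : ℝ) < Fintype.card V * (Fintype.card V - 1) := by nlinarith
  refine le_of_mul_le_mul_right ?_ hpos
  nlinarith [mul_le_mul_of_nonneg_left h1 (by linarith : (0 : ℝ) ≤ Fintype.card V - 2)]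

/-- The separated case with a single separating vertex. -/
lemma mul_card_add_card_sub_one_le_sum (J : Finset ι) (T : ι → Finset V) (A B U : Finset V)
    (hAB : Disjoint A B) (hAU : Disjoint A U) (hBU : Disjoint B U)
    (hA : A.Nonempty) (hB : B.Nonempty) (r : ℝ) (h3 : ∀ j ∈ J, 3 ≤ (T j).card)
    (hsep : ∀ j ∈ J, (T j ∩ A).Nonempty → (T j ∩ B).Nonempty → (T j ∩ U).Nonempty)
    (h : ∀ x ∈ A, ∀ y ∈ B, r ≤ (J.filter fun j => x ∈ T j ∧ y ∈ T j).card) :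
    r * (A.card + B.card - 1) ≤ ∑ j ∈ J, ((T j).card - 2 : ℝ) := by
  obtain ⟨a, ha⟩ := hA
  obtain ⟨b, hb⟩ := hB
  have h1 := mul_card_mul_card_le_sum J T A {b} r fun x hx y hy => by
    rw [Finset.mem_singleton.1 hy]; exact h x hx b hb
  have h2 := mul_card_mul_card_le_sum J T {a} (B.erase b) r fun x hx y hy => by
    rw [Finset.mem_singleton.1 hx]; exact h a ha y (Finset.mem_of_mem_erase hy)
  have hBc : ((B.erase b).card : ℝ) = B.card - 1 := by
    rw [Finset.card_erase_of_mem hb, Nat.cast_sub (Finset.card_pos.2 ⟨b, hb⟩)]; simp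
  rw [hBc] at h2
  simp only [Finset.card_singleton, Nat.cast_one] at h1 h2
  have h4 : ∑ j ∈ J, (((T j ∩ A).card : ℝ) * (T j ∩ {b}).card +
      (T j ∩ {a}).card * (T j ∩ B.erase b).card) ≤ ∑ j ∈ J, ((T j).card - 2 : ℝ) := by
    refine Finset.sum_le_sum fun j hj => ?_
    have hB' : (T j ∩ B).card = (T j ∩ {b}).card + (T j ∩ B.erase b).card := by
      rw [← Finset.card_union_of_disjoint]
      · congr 1; ext x; by_cases x = b <;> simp_all
      · rw [Finset.disjoint_left]; intro x; simp; tauto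
    have hle : (T j ∩ A).card + (T j ∩ B).card + (T j ∩ U).card ≤ (T j).card := by
      rw [← Finset.card_union_of_disjoint, ← Finset.card_union_of_disjoint]
      · exact Finset.card_le_card (by intro x; simp; tauto)
      · rw [Finset.disjoint_left] at *; intro x; simp; tauto
      · rw [Finset.disjoint_left] at *; intro x; simp; tauto
    have hδ : (T j ∩ {b}).card ≤ 1 :=
      (Finset.card_le_card Finset.inter_subset_right).trans (by simp)
    have hε : (T j ∩ {a}).card ≤ 1 :=
      (Finset.card_le_card Finset.inter_subset_right).trans (by simp)
    have hεp : (T j ∩ {a}).card ≤ (T j ∩ A).card :=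
      Finset.card_le_card (Finset.inter_subset_inter_left (by simpa using ha))
    have hs := hsep j hj
    simp only [← Finset.card_pos] at hs
    have hT := h3 j hj
    generalize (T j ∩ A).card = p at *
    generalize (T j ∩ {b}).card = δ at *
    generalize (T j ∩ {a}).card = ε at *
    generalize (T j ∩ B.erase b).card = q at *
    generalize (T j ∩ B).card = q' at *
    generalize (T j ∩ U).card = t at *
    generalize (T j).card = N at *
    have : p * δ + ε * q + 2 ≤ N := by
      interval_cases δ <;> interval_cases ε <;> omega
    have : ((p * δ + ε * q + 2 : ℕ) : ℝ) ≤ N := by exact_mod_cast this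
    push_cast at this
    linarith
  rw [Finset.sum_add_distrib] at h4
  linarith

/-- The contribution of a single set to the count in the separated case. -/
lemma separated_weight_le {p m q t d N s : ℕ} (hp : p ≤ 2) (hd : d ≤ 1) (hdq : d ≤ q)
    (hs : 2 ≤ s) (hts : t ≤ s) (hN : p + m + q + t ≤ N) (hN3 : 3 ≤ N)
    (hsep : 0 < p + m → 0 < q → 0 < t) :
    ((p * q : ℝ) * (1 / 2) + m * d + (p * t : ℝ) * (1 / s) +
      (t * (t - 1) : ℝ) * ((s - 2) / (s * (s - 1)))) ≤ N - 2 := by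
  have hs' : (2 : ℝ) ≤ s := by exact_mod_cast hs
  have hts' : (t : ℝ) ≤ s := by exact_mod_cast hts
  have hN' : (p + m + q + t : ℝ) ≤ N := by exact_mod_cast hN
  have hN3' : (3 : ℝ) ≤ N := by exact_mod_cast hN3
  have hss : (0 : ℝ) < s * (s - 1) := by nlinarith
  have hs0 : (0 : ℝ) < s := by linarith
  obtain ⟨x, hx⟩ : ∃ x : ℝ, x = t * (1 / s) := ⟨_, rfl⟩
  obtain ⟨g, hg⟩ : ∃ g : ℝ, g = (t * (t - 1) : ℝ) * ((s - 2) / (s * (s - 1))) := ⟨_, rfl⟩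
  have hx0 : 0 ≤ x := by rw [hx]; positivity
  have hx1 : x ≤ 1 := by
    rw [hx, mul_one_div, div_le_one hs0]; exact hts'
  have hm0 : (0 : ℝ) ≤ m := m.cast_nonneg
  have hq0 : (0 : ℝ) ≤ q := q.cast_nonneg
  have hdq' : (d : ℝ) ≤ q := by exact_mod_cast hdq
  rw [mul_assoc (p : ℝ) (t : ℝ), ← hx, ← hg]
  have hpc : (p : ℝ) = 0 ∨ (p : ℝ) = 1 ∨ (p : ℝ) = 2 := by
    norm_cast; omega
  have hdc : (d : ℝ) = 0 ∨ (d : ℝ) = 1 := by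
    norm_cast; omega
  have hqc : (q : ℝ) = 0 ∨ (1 : ℝ) ≤ q := by
    norm_cast; omega
  have hmc : (m : ℝ) = 0 ∨ (1 : ℝ) ≤ m := by
    norm_cast; omega
  obtain rfl | rfl | rfl | ht : t = 0 ∨ t = 1 ∨ t = 2 ∨ 3 ≤ t := by omega
  · have hx' : x = 0 := by simp [hx]
    have hg' : g = 0 := by simp [hg]
    subst hx' hg'
    have hpq : p + m = 0 ∨ q = 0 := by
      by_contra! h
      exact absurd (hsep (by omega) (by omega)) (lt_irrefl 0)
    rcases hpq with h | rfl
    · obtain ⟨rfl, rfl⟩ : p = 0 ∧ m = 0 := by omega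
      norm_num; linarith
    · obtain rfl : d = 0 := by omega
      norm_num; linarith
  · have hx' : x ≤ 1 / 2 := by
      rw [hx, Nat.cast_one, one_mul]
      exact one_div_le_one_div_of_le (by norm_num) hs'
    have hg' : g = 0 := by simp [hg]
    subst hg'
    push_cast at hN'
    rcases hpc with h | h | h <;> rcases hdc with h' | h' <;> rw [h, h'] <;>
      rcases hqc with hqc | hqc <;> rcases hmc with hmc | hmc <;> linarith
  · have hg' : g ≤ 1 - x := by
      have : 0 ≤ 1 - x - g := by
        have h2 : 1 - x - g = (s - 2) * (s - 3) / (s * (s - 1)) := by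
          rw [hx, hg]
          have : (s : ℝ) - 1 ≠ 0 := by linarith
          push_cast
          field_simp
          ring
        rw [h2]
        refine div_nonneg ?_ hss.le
        obtain rfl | h : s = 2 ∨ 3 ≤ s := by omega
        · norm_num
        · have : (3 : ℝ) ≤ s := by exact_mod_cast h
          nlinarith
      linarith
    push_cast at hN'
    rcases hpc with h | h | h <;> rcases hdc with h' | h' <;> rw [h, h'] <;>
      rcases hqc with hqc | hqc <;> rcases hmc with hmc | hmc <;> linarith
  · have hg' : g ≤ t - 2 := by
      rw [hg, ← mul_div_assoc, div_le_iff₀ hss]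
      have := sub_two_mul_pairs_le ht hts
      linarith
    rcases hpc with h | h | h <;> rcases hdc with h' | h' <;> rw [h, h'] <;>
      rcases hqc with hqc | hqc <;> rcases hmc with hmc | hmc <;> linarith

/-- The separated case with at least two separating vertices. -/
lemma mul_card_add_card_sub_two_add_le_sum (J : Finset ι) (T : ι → Finset V) (A B U : Finset V)
    (hAB : Disjoint A B) (hAU : Disjoint A U) (hBU : Disjoint B U)
    (hA : 2 ≤ A.card) (hB : B.Nonempty) (hU : 2 ≤ U.card) (r r' : ℝ)
    (h3 : ∀ j ∈ J, 3 ≤ (T j).card)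
    (hsep : ∀ j ∈ J, (T j ∩ A).Nonempty → (T j ∩ B).Nonempty → (T j ∩ U).Nonempty)
    (h : ∀ x ∈ A, ∀ y ∈ B, r ≤ (J.filter fun j => x ∈ T j ∧ y ∈ T j).card)
    (h' : ∀ x y, x ≠ y → r' ≤ (J.filter fun j => x ∈ T j ∧ y ∈ T j).card) :
    r * (A.card + B.card - 2) + r' * U.card ≤ ∑ j ∈ J, ((T j).card - 2 : ℝ) := by
  obtain ⟨P, hPA, hP⟩ := Finset.exists_subset_card_eq hA
  obtain ⟨b, hb⟩ := hB
  have h1 := mul_card_mul_card_le_sum J T P B r fun x hx y hy => h x (hPA hx) y hy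
  have h2 := mul_card_mul_card_le_sum J T (A \ P) {b} r fun x hx y hy => by
    rw [Finset.mem_singleton.1 hy]; exact h x (Finset.mem_sdiff.1 hx).1 b hb
  have h4 := mul_card_mul_card_le_sum J T P U r' fun x hx y hy => h' x y (by
    rintro rfl; exact Finset.disjoint_left.1 hAU (hPA hx) hy)
  have h5 := mul_card_mul_card_sub_one_le_sum J T U r' fun x _ y _ => h' x y
  have hAc : ((A \ P).card : ℝ) = A.card - 2 := by
    rw [Finset.card_sdiff_of_subset hPA, Nat.cast_sub (Finset.card_le_card hPA), hP]; simp
  rw [hAc] at h2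
  rw [hP] at h1 h4
  simp only [Finset.card_singleton, Nat.cast_one, Nat.cast_ofNat] at h1 h2 h4
  have hU' : (2 : ℝ) ≤ U.card := by exact_mod_cast hU
  set s : ℝ := (U.card : ℝ)
  have h6 : ∑ j ∈ J, (((T j ∩ P).card * (T j ∩ B).card : ℝ) * (1 / 2) +
      (T j ∩ (A \ P)).card * (T j ∩ {b}).card +
      ((T j ∩ P).card * (T j ∩ U).card : ℝ) * (1 / s) +
      ((T j ∩ U).card * ((T j ∩ U).card - 1) : ℝ) * ((s - 2) / (s * (s - 1)))) ≤
      ∑ j ∈ J, ((T j).card - 2 : ℝ) := by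
    refine Finset.sum_le_sum fun j hj => ?_
    have hA' : (T j ∩ A).card = (T j ∩ P).card + (T j ∩ (A \ P)).card := by
      rw [← Finset.card_union_of_disjoint]
      · congr 1; ext x; have := @hPA x; simp; tauto
      · rw [Finset.disjoint_left]; intro x; simp; tauto
    have hle : (T j ∩ A).card + (T j ∩ B).card + (T j ∩ U).card ≤ (T j).card := by
      rw [← Finset.card_union_of_disjoint, ← Finset.card_union_of_disjoint]
      · exact Finset.card_le_card (by intro x; simp; tauto)
      · rw [Finset.disjoint_left] at *; intro x; simp; tauto
      · rw [Finset.disjoint_left] at *; intro x; simp; tauto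
    have hδ : (T j ∩ {b}).card ≤ 1 :=
      (Finset.card_le_card Finset.inter_subset_right).trans (by simp)
    have hδq : (T j ∩ {b}).card ≤ (T j ∩ B).card :=
      Finset.card_le_card (Finset.inter_subset_inter_left (by simpa using hb))
    have hP2 : (T j ∩ P).card ≤ 2 := hP ▸ Finset.card_le_card Finset.inter_subset_right
    have htU : (T j ∩ U).card ≤ U.card := Finset.card_le_card Finset.inter_subset_right
    have hs := hsep j hj
    simp only [← Finset.card_pos] at hs
    have hT := h3 j hj
    exact separated_weight_le hP2 hδ hδq hU htU (hA' ▸ hle) hT (hA' ▸ hs)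
  simp only [Finset.sum_add_distrib, ← Finset.sum_mul] at h6
  have h7 := mul_le_mul_of_nonneg_right h1 (by norm_num : (0 : ℝ) ≤ 1 / 2)
  have h8 := mul_le_mul_of_nonneg_right h4 (by positivity : (0 : ℝ) ≤ 1 / s)
  have h9 := mul_le_mul_of_nonneg_right h5
    (div_nonneg (by linarith) (by nlinarith) : (0 : ℝ) ≤ (s - 2) / (s * (s - 1)))
  have e8 : r' * (2 * s) * (1 / s) = r' * 2 := by field_simp
  have e9 : r' * (s * (s - 1)) * ((s - 2) / (s * (s - 1))) = r' * (s - 2) := by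
    have : s - 1 ≠ 0 := by linarith
    field_simp
  rw [e8] at h8
  rw [e9] at h9
  linarith

end Counting

namespace SimpleGraph

variable {V : Type*} (G : SimpleGraph V) (c : Sym2 V → ℕ)

/-- The spanning subgraph of `G` formed by the edges of color `i`. -/
def colorClass_s10 (i : ℕ) : SimpleGraph V where
  Adj u v := G.Adj u v ∧ c s(u, v) = i
  symm := ⟨fun u v h => ⟨h.1.symm, by rw [Sym2.eq_swap]; exact h.2⟩⟩
  loopless := ⟨fun u h => G.loopless.irrefl u h.1⟩

variable {G c}

lemma Walk.IsMonochromatic.reachable_colorClass_s10 {i : ℕ} {u v : V} {W : G.Walk u v}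
    (h : W.IsMonochromatic c i) : (G.colorClass_s10 c i).Reachable u v := by
  induction W with
  | nil => exact Reachable.refl _
  | cons hadj W ih =>
    simp only [Walk.IsMonochromatic, Walk.edges_cons, List.mem_cons, forall_eq_or_imp] at h
    have h1 : (G.colorClass_s10 c i).Adj _ _ := ⟨hadj, h.1⟩
    exact h1.reachable.trans (ih h.2)

variable [Fintype V]

open scoped Classical in
/-- The vertex set of the connected component of `u` in color `i`. -/
noncomputable def colorComponent (G : SimpleGraph V) (c : Sym2 V → ℕ) (i : ℕ) (u : V) : Finset V :=
  Finset.univ.filter fun w => (G.colorClass_s10 c i).Reachable u w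

lemma mem_colorComponent {i : ℕ} {u w : V} :
    w ∈ G.colorComponent c i u ↔ (G.colorClass_s10 c i).Reachable u w := by
  simp [colorComponent]

lemma colorComponent_congr {i : ℕ} {u v : V} (h : (G.colorClass_s10 c i).Reachable u v) :
    G.colorComponent c i u = G.colorComponent c i v := by
  ext w
  simp only [mem_colorComponent]
  exact ⟨h.symm.trans, h.trans⟩

/-- The color of an edge, with the vertex set of its monochromatic component. -/
noncomputable def edgeBlock (G : SimpleGraph V) (c : Sym2 V → ℕ) (e : Sym2 V) : ℕ × Finset V :=
  (c e, G.colorComponent c (c e) (Quot.out e).1)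

open scoped Classical in
/-- All nontrivial monochromatic components, labelled by their colors. -/
noncomputable def colorBlocks (G : SimpleGraph V) (c : Sym2 V → ℕ) : Finset (ℕ × Finset V) :=
  G.edgeFinset.image (G.edgeBlock c)

lemma edgeBlock_mk {u v : V} (h : G.Adj u v) :
    G.edgeBlock c s(u, v) = (c s(u, v), G.colorComponent c (c s(u, v)) u) := by
  have hadj : (G.colorClass_s10 c (c s(u, v))).Adj u v := ⟨h, rfl⟩
  have hmem : (Quot.out s(u, v)).1 ∈ s(u, v) := Sym2.out_fst_mem _
  rw [edgeBlock, Prod.mk.injEq]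
  refine ⟨rfl, ?_⟩
  rcases Sym2.mem_iff.1 hmem with h' | h'
  · rw [h']
  · rw [h']
    exact colorComponent_congr hadj.reachable.symm

lemma mem_colorBlocks {j : ℕ × Finset V} :
    j ∈ G.colorBlocks c ↔
      ∃ u v, (G.colorClass_s10 c j.1).Adj u v ∧ j.2 = G.colorComponent c j.1 u := by
  classical
  simp only [colorBlocks, Finset.mem_image, mem_edgeFinset]
  constructor
  · rintro ⟨e, he, rfl⟩
    induction e using Sym2.ind with
    | _ u v =>
      rw [mem_edgeSet] at he
      rw [edgeBlock_mk he]
      exact ⟨u, v, ⟨he, rfl⟩, rfl⟩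
  · rintro ⟨u, v, ⟨h1, h2⟩, h3⟩
    refine ⟨s(u, v), h1, ?_⟩
    rw [edgeBlock_mk h1, h2, ← h3]

lemma mk_colorComponent_mem_colorBlocks {i : ℕ} {u v : V} (huv : u ≠ v)
    (h : (G.colorClass_s10 c i).Reachable u v) :
    (i, G.colorComponent c i u) ∈ G.colorBlocks c := by
  obtain ⟨W⟩ := h
  cases W with
  | nil => exact absurd rfl huv
  | cons hadj _ => exact mem_colorBlocks.2 ⟨_, _, hadj, rfl⟩

open scoped Classical in
lemma card_le_card_edges_add_one_of_mem_colorBlocks {j : ℕ × Finset V} (hj : j ∈ G.colorBlocks c) :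
    j.2.card ≤ (G.edgeFinset.filter fun e => G.edgeBlock c e = j).card + 1 := by
  obtain ⟨u, -, -, h⟩ := mem_colorBlocks.1 hj
  obtain ⟨i, S⟩ := j
  simp only at h
  subst h
  let C := (G.colorClass_s10 c i).connectedComponentMk u
  have h1 := C.connected_toSimpleGraph.card_vert_le_card_edgeSet_add_one
  have h2 : Nat.card C = (G.colorComponent c i u).card := by
    rw [← Nat.card_eq_finsetCard]
    refine Nat.card_congr (Equiv.subtypeEquivRight fun v => ?_)
    rw [mem_colorComponent, reachable_comm]
    exact ConnectedComponent.eq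
  rw [h2] at h1
  refine h1.trans (Nat.add_le_add_right ?_ 1)
  rw [← Nat.card_eq_finsetCard]
  refine Nat.card_le_card_of_injective
    (fun e => ⟨e.1.map Subtype.val, ?_⟩) ?_
  · obtain ⟨e, he⟩ := e
    induction e using Sym2.ind with
    | _ x y =>
      obtain ⟨x, hx⟩ := x
      obtain ⟨y, hy⟩ := y
      have hadj : (G.colorClass_s10 c i).Adj x y := he
      have hx' : (G.colorClass_s10 c i).Reachable x u := ConnectedComponent.exact hx
      simp only [Sym2.map_mk, Finset.mem_filter, mem_edgeFinset]
      refine ⟨hadj.1, ?_⟩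
      rw [edgeBlock_mk hadj.1, hadj.2, colorComponent_congr hx']
  · intro e f hef
    exact Subtype.ext (Sym2.map.injective Subtype.val_injective (congrArg Subtype.val hef))

open scoped Classical in
/-- The number of colors plus the total excess of the monochromatic components is at most the
number of edges. -/
lemma colorsUsed_add_sum_le :
    G.colorsUsed c + ∑ j ∈ (G.colorBlocks c).filter (fun j => 3 ≤ j.2.card), (j.2.card - 2) ≤
      G.edgeSet.ncard := by
  have h1 : G.colorsUsed c ≤ (G.colorBlocks c).card := by
    have : c '' G.edgeSet = ((G.colorBlocks c).image Prod.fst : Finset ℕ) := by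
      ext i
      simp [colorBlocks, edgeBlock]
    rw [colorsUsed, this, Set.ncard_coe_finset]
    exact Finset.card_image_le
  have h2 : G.edgeSet.ncard = ∑ j ∈ G.colorBlocks c,
      (G.edgeFinset.filter fun e => G.edgeBlock c e = j).card := by
    rw [← coe_edgeFinset, Set.ncard_coe_finset, Finset.card_eq_sum_card_image (G.edgeBlock c)]
    rfl
  have h3 : ∀ j ∈ G.colorBlocks c, 1 + (j.2.card - 2) ≤
      (G.edgeFinset.filter fun e => G.edgeBlock c e = j).card := by
    intro j hj
    have := card_le_card_edges_add_one_of_mem_colorBlocks hj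
    have : 0 < (G.edgeFinset.filter fun e => G.edgeBlock c e = j).card := by
      obtain ⟨e, he, rfl⟩ := Finset.mem_image.1 hj
      exact Finset.card_pos.2 ⟨e, Finset.mem_filter.2 ⟨he, rfl⟩⟩
    omega
  have h4 := Finset.sum_le_sum h3
  rw [Finset.sum_add_distrib, Finset.sum_const, smul_eq_mul, mul_one, ← h2] at h4
  have h5 : ∑ j ∈ (G.colorBlocks c).filter (fun j => 3 ≤ j.2.card), (j.2.card - 2) ≤
      ∑ j ∈ G.colorBlocks c, (j.2.card - 2) :=
    Finset.sum_le_sum_of_subset (Finset.filter_subset _ _)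
  omega

open scoped Classical in
lemma IsRMCColoring.le_card_colorBlocks {k : ℕ} (h : G.IsRMCColoring k c) {u v : V} (huv : u ≠ v) :
    k ≤ ((G.colorBlocks c).filter fun j => u ∈ j.2 ∧ v ∈ j.2).card := by
  obtain ⟨P, col, -, hmono, -, hinj⟩ := h u v huv
  have hmaps : ∀ i ∈ (Finset.univ : Finset (Fin k)), (col i, G.colorComponent c (col i) u) ∈
      (G.colorBlocks c).filter fun j => u ∈ j.2 ∧ v ∈ j.2 := by
    intro i _
    have hr := (hmono i).reachable_colorClass_s10
    exact Finset.mem_filter.2 ⟨mk_colorComponent_mem_colorBlocks huv hr,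
      mem_colorComponent.2 (Reachable.refl _), mem_colorComponent.2 hr⟩
  simpa using Finset.card_le_card_of_injOn _ hmaps
    fun i _ i' _ hii => hinj (congrArg Prod.fst hii)

/-- A monochromatic component with two vertices is the block of the edge joining them. -/
lemma eq_edgeBlock_of_card_lt_three {j : ℕ × Finset V} (hj : j ∈ G.colorBlocks c)
    (hcard : j.2.card < 3) {u v : V} (huv : u ≠ v) (hu : u ∈ j.2) (hv : v ∈ j.2) :
    G.Adj u v ∧ j = G.edgeBlock c s(u, v) := by
  classical
  obtain ⟨x, y, hxy, h⟩ := mem_colorBlocks.1 hj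
  have hx : x ∈ j.2 := by rw [h, mem_colorComponent]
  have hy : y ∈ j.2 := by rw [h, mem_colorComponent]; exact hxy.reachable
  have hsub : ∀ {a b : V}, a ≠ b → a ∈ j.2 → b ∈ j.2 → j.2 = {a, b} := fun hab ha hb =>
    (Finset.eq_of_subset_of_card_le (by
      intro z hz
      rcases Finset.mem_insert.1 hz with rfl | hz
      · exact ha
      · rwa [Finset.mem_singleton.1 hz]) (by rw [Finset.card_pair hab]; omega)).symm
  have hS := hsub hxy.1.ne hx hy
  rw [hS] at hu hv
  have he : s(u, v) = s(x, y) := by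
    simp only [Finset.mem_insert, Finset.mem_singleton] at hu hv
    rw [Sym2.eq_iff]
    rcases hu with rfl | rfl <;> rcases hv with rfl | rfl <;> simp_all
  refine ⟨by rw [← mem_edgeSet, he]; exact hxy.1, ?_⟩
  rw [he, edgeBlock_mk hxy.1, hxy.2, ← h]

open scoped Classical in
lemma IsRMCColoring.le_card_colorBlocks_of_not_adj {k : ℕ} (h : G.IsRMCColoring k c) {u v : V}
    (huv : u ≠ v) (hadj : ¬ G.Adj u v) :
    k ≤ (((G.colorBlocks c).filter fun j => 3 ≤ j.2.card).filter
      fun j => u ∈ j.2 ∧ v ∈ j.2).card := by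
  refine (h.le_card_colorBlocks huv).trans (Finset.card_le_card fun j hj => ?_)
  simp only [Finset.mem_filter] at hj ⊢
  refine ⟨⟨hj.1, ?_⟩, hj.2⟩
  by_contra! hlt
  exact hadj (eq_edgeBlock_of_card_lt_three hj.1 hlt huv hj.2.1 hj.2.2).1

open scoped Classical in
lemma IsRMCColoring.le_card_colorBlocks_add_one {k : ℕ} (h : G.IsRMCColoring k c) {u v : V}
    (huv : u ≠ v) :
    k ≤ (((G.colorBlocks c).filter fun j => 3 ≤ j.2.card).filter
      fun j => u ∈ j.2 ∧ v ∈ j.2).card + 1 := by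
  refine (h.le_card_colorBlocks huv).trans ((Finset.card_le_card fun j hj => ?_).trans
    (Finset.card_insert_le (G.edgeBlock c s(u, v)) _))
  simp only [Finset.mem_insert, Finset.mem_filter] at hj ⊢
  by_cases hlt : j.2.card < 3
  · exact Or.inl (eq_edgeBlock_of_card_lt_three hj.1 hlt huv hj.2.1 hj.2.2).2
  · exact Or.inr ⟨⟨hj.1, not_lt.1 hlt⟩, hj.2⟩

/-- A monochromatic component meeting both sides of a separation meets the separator. -/
lemma inter_separator_nonempty [DecidableEq V] {A B U : Finset V}
    (hcov : ∀ v, v ∈ A ∨ v ∈ B ∨ v ∈ U)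
    (hAB : Disjoint A B) (hnadj : ∀ a ∈ A, ∀ b ∈ B, ¬ G.Adj a b)
    {j : ℕ × Finset V} (hj : j ∈ G.colorBlocks c)
    (hA : (j.2 ∩ A).Nonempty) (hB : (j.2 ∩ B).Nonempty) : (j.2 ∩ U).Nonempty := by
  obtain ⟨x, -, -, h⟩ := mem_colorBlocks.1 hj
  obtain ⟨a, ha⟩ := hA
  obtain ⟨b, hb⟩ := hB
  rw [Finset.mem_inter, h, mem_colorComponent] at ha hb
  by_contra hU
  have key : ∀ {y z : V}, (G.colorClass_s10 c j.1).Walk y z → (G.colorClass_s10 c j.1).Reachable x y →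
      y ∈ A → z ∈ A := by
    intro y z W
    induction W with
    | nil => exact fun _ h => h
    | @cons y w z hadj W ih =>
      intro hxy hyA
      have hxw := hxy.trans hadj.reachable
      refine ih hxw ?_
      rcases hcov w with hw | hw | hw
      · exact hw
      · exact absurd hadj.1 (hnadj _ hyA _ hw)
      · exact absurd ⟨w, Finset.mem_inter.2 ⟨by rw [h, mem_colorComponent]; exact hxw, hw⟩⟩ hU
  obtain ⟨W⟩ := ha.1.symm.trans hb.1
  exact Finset.disjoint_left.1 hAB (key W ha.1 ha.2) hb.2

/-- A graph of order greater than `s + 2` which is not `(s+1)`-connected has a separation of order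
at most `s`. -/
lemma exists_separation_of_not_isKConnected [DecidableEq V] {s : ℕ} (h : ¬ G.IsKConnected (s + 1))
    (hs : s + 2 < Fintype.card V) :
    ∃ A B U : Finset V, (∀ v, v ∈ A ∨ v ∈ B ∨ v ∈ U) ∧ Disjoint A B ∧ Disjoint A U ∧
      Disjoint B U ∧ A.Nonempty ∧ B.Nonempty ∧ U.card ≤ s ∧ ∀ a ∈ A, ∀ b ∈ B, ¬ G.Adj a b := by
  classical
  simp only [IsKConnected, not_and, not_forall] at h
  obtain ⟨U, hU, hcon⟩ := h (by omega)
  have hne : Nonempty (Uᶜ : Set V) := by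
    by_contra hemp
    have : U = Set.univ := by
      rw [← Set.compl_empty_iff]
      exact Set.not_nonempty_iff_eq_empty.1 (by rwa [← Set.nonempty_coe_sort])
    rw [this, Set.ncard_univ, Nat.card_eq_fintype_card] at hU
    omega
  have hpre : ¬ (G.induce (Uᶜ : Set V)).Preconnected := fun hp => hcon ⟨hp⟩
  simp only [Preconnected, not_forall] at hpre
  obtain ⟨x, y, hxy⟩ := hpre
  refine ⟨Finset.univ.filter fun v => ∃ hv : v ∈ Uᶜ, (G.induce (Uᶜ : Set V)).Reachable x ⟨v, hv⟩,
    Finset.univ.filter fun v => ∃ hv : v ∈ Uᶜ, ¬ (G.induce (Uᶜ : Set V)).Reachable x ⟨v, hv⟩,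
    U.toFinset, ?_, ?_, ?_, ?_, ⟨x, ?_⟩, ⟨y, ?_⟩, ?_, ?_⟩
  · intro v
    by_cases hv : v ∈ U
    · simp [hv]
    · by_cases hr : (G.induce (Uᶜ : Set V)).Reachable x ⟨v, hv⟩ <;> simp [hv, hr]
  · rw [Finset.disjoint_left]
    intro v
    simp only [Finset.mem_filter, Finset.mem_univ, true_and, not_exists, not_not]
    exact fun ⟨_, h1⟩ _ => h1
  · rw [Finset.disjoint_left]
    intro v
    simp only [Finset.mem_filter, Finset.mem_univ, true_and, Set.mem_toFinset]
    exact fun ⟨h1, _⟩ => h1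
  · rw [Finset.disjoint_left]
    intro v
    simp only [Finset.mem_filter, Finset.mem_univ, true_and, Set.mem_toFinset]
    exact fun ⟨h1, _⟩ => h1
  · exact Finset.mem_filter.2 ⟨Finset.mem_univ _, x.2, Reachable.refl _⟩
  · exact Finset.mem_filter.2 ⟨Finset.mem_univ _, y.2, hxy⟩
  · rw [← Set.ncard_eq_toFinset_card']
    omega
  · intro a ha b hb hab
    obtain ⟨-, ha, hxa⟩ := Finset.mem_filter.1 ha
    obtain ⟨-, hb, hxb⟩ := Finset.mem_filter.1 hb
    have hadj : (G.induce (Uᶜ : Set V)).Adj ⟨a, ha⟩ ⟨b, hb⟩ := hab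
    exact hxb (hxa.trans hadj.reachable)

/-- The excess of the monochromatic components of an `RMC_k`-coloring. -/
lemma IsRMCColoring.colorsUsed_add_le {k s : ℕ} (hk : 1 ≤ k) (h : G.IsRMCColoring k c)
    (hcon : ¬ G.IsKConnected (s + 1)) (hn : 3 ≤ Fintype.card V) :
    G.colorsUsed c + k * (Fintype.card V - 2) ≤ G.edgeSet.ncard + s := by
  classical
  have hcol := G.colorsUsed_add_sum_le (c := c)
  set J := (G.colorBlocks c).filter fun j => 3 ≤ j.2.card with hJ
  have h3 : ∀ j ∈ J, 3 ≤ j.2.card := fun j hj => (Finset.mem_filter.1 hj).2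
  have hcast : ((∑ j ∈ J, (j.2.card - 2) : ℕ) : ℝ) = ∑ j ∈ J, (j.2.card - 2 : ℝ) := by
    rw [Nat.cast_sum]
    refine Finset.sum_congr rfl fun j hj => ?_
    have := h3 j hj
    rw [Nat.cast_sub (by omega)]
    norm_num
  have hpair : ∀ x y, x ≠ y → (k - 1 : ℝ) ≤ (J.filter fun j => x ∈ j.2 ∧ y ∈ j.2).card := by
    intro x y hxy
    have : (k : ℝ) ≤ (J.filter fun j => x ∈ j.2 ∧ y ∈ j.2).card + 1 := by
      exact_mod_cast h.le_card_colorBlocks_add_one hxy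
    linarith
  have hk' : (1 : ℝ) ≤ k := by exact_mod_cast hk
  suffices hmain : (k : ℝ) * (Fintype.card V - 2) - s ≤ ∑ j ∈ J, (j.2.card - 2 : ℝ) by
    rw [← hcast] at hmain
    have hmain' : ((k * (Fintype.card V - 2) : ℕ) : ℝ) ≤
        ((∑ j ∈ J, (j.2.card - 2) + s : ℕ) : ℝ) := by
      rw [Nat.cast_mul, Nat.cast_sub (by omega), Nat.cast_add]
      push_cast at hmain ⊢
      linarith
    have := Nat.cast_le.1 hmain'
    omega
  by_cases hs : s + 2 < Fintype.card V
  · obtain ⟨A, B, U, hcov, hAB, hAU, hBU, hA, hB, hUs, hnadj⟩ :=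
      exists_separation_of_not_isKConnected hcon hs
    have hsum : A.card + B.card + U.card = Fintype.card V := by
      rw [← Finset.card_union_of_disjoint hAB, ← Finset.card_union_of_disjoint
        (Finset.disjoint_union_left.2 ⟨hAU, hBU⟩), ← Finset.card_univ]
      congr 1
      ext v
      simpa [or_assoc] using hcov v
    have hcross : ∀ a ∈ A, ∀ b ∈ B, (k : ℝ) ≤ (J.filter fun j => a ∈ j.2 ∧ b ∈ j.2).card := by
      intro a ha b hb
      exact_mod_cast h.le_card_colorBlocks_of_not_adj
        (ne_of_mem_of_not_mem ha (Finset.disjoint_right.1 hAB hb)) (hnadj a ha b hb)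
    have hsep : ∀ j ∈ J, (j.2 ∩ A).Nonempty → (j.2 ∩ B).Nonempty → (j.2 ∩ U).Nonempty :=
      fun j hj => inter_separator_nonempty hcov hAB hnadj (Finset.mem_filter.1 hj).1
    have hsum' : (A.card + B.card + U.card : ℝ) = Fintype.card V := by exact_mod_cast hsum
    have hUs' : (U.card : ℝ) ≤ s := by exact_mod_cast hUs
    obtain hU | hU | hU : U.card = 0 ∨ U.card = 1 ∨ 2 ≤ U.card := by omega
    · obtain ⟨a, ha⟩ := hA
      obtain ⟨b, hb⟩ := hB
      have hpos : (0 : ℝ) < (J.filter fun j => a ∈ j.2 ∧ b ∈ j.2).card := by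
        linarith [hcross a ha b hb]
      obtain ⟨j, hj⟩ := Finset.card_pos.1 (Nat.cast_pos.1 hpos)
      obtain ⟨hj, haj, hbj⟩ := Finset.mem_filter.1 hj
      have := hsep j hj ⟨a, Finset.mem_inter.2 ⟨haj, ha⟩⟩ ⟨b, Finset.mem_inter.2 ⟨hbj, hb⟩⟩
      simp [Finset.card_eq_zero.1 hU] at this
    · have := mul_card_add_card_sub_one_le_sum J Prod.snd A B U hAB hAU hBU hA hB k h3 hsep hcross
      rw [hU, Nat.cast_one] at hsum'
      rw [← hsum']
      have hs0 : (0 : ℝ) ≤ s := s.cast_nonneg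
      linarith
    · have hbound : (k : ℝ) * (A.card + B.card - 2) + (k - 1) * U.card ≤
          ∑ j ∈ J, (j.2.card - 2 : ℝ) := by
        by_cases hA2 : 2 ≤ A.card
        · exact mul_card_add_card_sub_two_add_le_sum J Prod.snd A B U hAB hAU hBU hA2 hB hU k
            (k - 1) h3 hsep hcross hpair
        · have hB2 : 2 ≤ B.card := by omega
          have := mul_card_add_card_sub_two_add_le_sum J Prod.snd B A U hAB.symm hBU hAU hB2 hA hU
            k (k - 1) h3 (fun j hj h1 h2 => hsep j hj h2 h1)
            (fun b hb a ha => by simpa only [and_comm] using hcross a ha b hb) hpair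
          rwa [add_comm (B.card : ℝ)] at this
      rw [← hsum']
      linarith
  · have := mul_card_sub_two_le_sum J Prod.snd (k - 1 : ℝ) hn h3 hpair
    have hs' : (Fintype.card V : ℝ) ≤ s + 2 := by exact_mod_cast not_lt.1 hs
    linarith

end SimpleGraph

/-- If `τ(G) ≥ k` and `G` is not `(s+1)`-connected, then `rmc_k(G) ≤ m - k(n-2) + s`. -/
theorem rmc_le_of_not_connected {V : Type*} [Fintype V] (G : SimpleGraph V) (k s : ℕ)
    (hk : 1 ≤ k) (htau : G.TauGE k) (hcon : ¬ G.IsKConnected (s + 1)) :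
    G.rmc k ≤ G.edgeSet.ncard - k * (Fintype.card V - 2) + s := by
  refine csSup_le' ?_
  rintro _ ⟨c, hc, rfl⟩
  by_cases hn : 3 ≤ Fintype.card V
  · have := hc.colorsUsed_add_le hk hcon hn
    omega
  · have h0 : Fintype.card V - 2 = 0 := by omega
    have := G.colorsUsed_add_sum_le (c := c)
    rw [h0]
    omega
end

section
/- Let G be a simple graph on n vertices with m edges, and let k ≥ 2 be an integer with τ(G) ≥ k. If G is not (k+1)-edge-connected (i.e., G has an edge cut of size at most k), then rmc_k(G) = m − k(n − 2). -/
open SimpleGraph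

namespace SimpleGraph

variable {V : Type*} {G : SimpleGraph V}

/-- The spanning subgraph of `G` formed by the edges of color `a`. -/
def colorGraph (G : SimpleGraph V) (c : Sym2 V → ℕ) (a : ℕ) : SimpleGraph V :=
  fromEdgeSet {e ∈ G.edgeSet | c e = a}

lemma edgeSet_colorGraph (c : Sym2 V → ℕ) (a : ℕ) :
    (G.colorGraph c a).edgeSet = {e ∈ G.edgeSet | c e = a} := by
  rw [colorGraph, edgeSet_fromEdgeSet, sdiff_eq_left, Set.disjoint_left]
  intro e he
  exact G.not_isDiag_of_mem_edgeSet he.1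

lemma Walk.IsMonochromatic.reachable_colorGraph {c : Sym2 V → ℕ} {u v : V} {W : G.Walk u v}
    {a : ℕ} (h : W.IsMonochromatic c a) : (G.colorGraph c a).Reachable u v :=
  ⟨W.transfer _ fun e he => by
    rw [edgeSet_colorGraph]
    exact ⟨W.edges_subset_edgeSet he, h e he⟩⟩

/-- A walk between vertices separated by deleting `S` uses an edge of `S`. -/
lemma Walk.exists_mem_edges_of_not_reachable {S : Set (Sym2 V)} {u v : V}
    (h : ¬ (G.deleteEdges S).Reachable u v) (W : G.Walk u v) : ∃ e ∈ W.edges, e ∈ S := by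
  by_contra! hW
  exact h ⟨W.toDeleteEdges S hW⟩

/-- If `K` is disconnected and any two vertices in different components of `K` are joined in `H`,
then `H` is connected. -/
lemma connected_of_forall_not_reachable {H K : SimpleGraph V} {u₀ v₀ : V}
    (h₀ : ¬ K.Reachable u₀ v₀) (h : ∀ u v, ¬ K.Reachable u v → H.Reachable u v) :
    H.Connected := by
  have key : ∀ x, H.Reachable u₀ x := by
    intro x
    by_cases hx : K.Reachable u₀ x
    · exact (h _ _ h₀).trans (h _ _ fun hv => h₀ (hx.trans hv.symm))
    · exact h _ _ hx
  exact connected_iff_exists_forall_reachable _ |>.2 ⟨u₀, key⟩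

/-- If deleting at most `k` edges separates `u` from `v`, then the `k` edges have distinct colors
and each of these colors joins `u` to `v`. -/
lemma IsRMCColoring.cut_colors [Finite V] {k : ℕ} {c : Sym2 V → ℕ} (hc : G.IsRMCColoring k c)
    {S : Set (Sym2 V)} (hS : S.ncard ≤ k) {u v : V}
    (huv : ¬ (G.deleteEdges S).Reachable u v) :
    (c '' S).ncard = k ∧ ∀ a ∈ c '' S, (G.colorGraph c a).Reachable u v := by
  have hne : u ≠ v := by
    rintro rfl
    exact huv (Reachable.refl _)
  obtain ⟨P, col, -, hmono, -, hinj⟩ := hc u v hne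
  have hsub : Set.range col ⊆ c '' S := by
    rintro _ ⟨i, rfl⟩
    obtain ⟨e, he, heS⟩ := (P i).exists_mem_edges_of_not_reachable huv
    exact ⟨e, heS, hmono i e he⟩
  have hrange : (Set.range col).ncard = k := by
    rw [← Set.image_univ, Set.ncard_image_of_injective _ hinj, Set.ncard_univ, Nat.card_fin]
  have hle : (c '' S).ncard ≤ k := (Set.ncard_image_le (Set.toFinite S)).trans hS
  have heq : Set.range col = c '' S :=
    Set.eq_of_subset_of_ncard_le hsub (by omega) (Set.toFinite _)
  refine ⟨heq ▸ hrange, ?_⟩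
  rw [← heq]
  rintro _ ⟨i, rfl⟩
  exact (hmono i).reachable_colorGraph

lemma Connected.card_le_ncard_edgeSet_add_one [Finite V] {H : SimpleGraph V} (h : H.Connected) :
    Nat.card V ≤ H.edgeSet.ncard + 1 := by
  rw [← Nat.card_coe_set_eq]
  exact h.card_vert_le_card_edgeSet_add_one

lemma IsTree.ncard_edgeSet_add_one [Finite V] {H : SimpleGraph V} (h : H.IsTree) :
    H.edgeSet.ncard + 1 = Nat.card V := by
  classical
  have := Fintype.ofFinite V
  rw [Nat.card_eq_fintype_card, ← h.card_edgeFinset, ← coe_edgeFinset, Set.ncard_coe_finset]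

/-- Merging the color classes in `C`, each having at least `r` elements, bounds the number of
colors. -/
lemma ncard_image_add_le {α : Type*} {E : Set α} (hE : E.Finite) (c : α → ℕ) (C : Finset ℕ)
    (r : ℕ) (hC : ∀ a ∈ C, r ≤ {e ∈ E | c e = a}.ncard) :
    (c '' E).ncard + C.card * r ≤ E.ncard + C.card := by
  classical
  lift E to Finset α using hE
  have hsplit := E.card_filter_add_card_filter_not (fun e => c e ∈ C)
  have hfib : C.card * r ≤ (E.filter fun e => c e ∈ C).card := by
    rw [Finset.card_eq_sum_card_fiberwise (f := c) (t := C) (fun e he => by simp_all),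
      ← smul_eq_mul]
    refine Finset.card_nsmul_le_sum _ _ _ fun a ha => (hC a ha).trans_eq ?_
    rw [← Set.ncard_coe_finset]
    congr 1
    ext e
    simp only [Finset.coe_filter, Finset.mem_filter, Set.mem_ofPred_eq, Finset.mem_coe]
    constructor
    · rintro ⟨h, rfl⟩
      exact ⟨⟨h, ha⟩, rfl⟩
    · rintro ⟨⟨h, -⟩, h'⟩
      exact ⟨h, h'⟩
  have himg : (c '' (E : Set α)).ncard ≤ C.card + (E.filter fun e => c e ∉ C).card := by
    rw [← Finset.coe_image, Set.ncard_coe_finset]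
    refine (Finset.card_le_card (t := C ∪ (E.filter fun e => c e ∉ C).image c) ?_).trans
      ((Finset.card_union_le _ _).trans (Nat.add_le_add_left Finset.card_image_le _))
    intro a ha
    obtain ⟨e, he, rfl⟩ := Finset.mem_image.1 ha
    by_cases h : c e ∈ C
    · exact Finset.mem_union_left _ h
    · exact Finset.mem_union_right _ (Finset.mem_image_of_mem _ (Finset.mem_filter.2 ⟨he, h⟩))
  rw [Set.ncard_coe_finset]
  omega

/-- The number of colors of an RMC coloring of a graph with an edge cut of size at most `k`. -/
lemma IsRMCColoring.colorsUsed_add_le_s13 [Finite V] {k : ℕ} {c : Sym2 V → ℕ}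
    (hc : G.IsRMCColoring k c) {S : Set (Sym2 V)} (hS : S.ncard ≤ k) {u v : V}
    (huv : ¬ (G.deleteEdges S).Reachable u v) :
    G.colorsUsed c + k * (Nat.card V - 1) ≤ G.edgeSet.ncard + k := by
  have hcard := (hc.cut_colors hS huv).1
  have hfin : (c '' S).Finite := Set.toFinite _
  have hbound := ncard_image_add_le (Set.toFinite G.edgeSet) c hfin.toFinset (Nat.card V - 1) (by
    intro a ha
    have hconn : (G.colorGraph c a).Connected :=
      connected_of_forall_not_reachable huv fun x y hxy =>
        (hc.cut_colors hS hxy).2 a (hfin.mem_toFinset.1 ha)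
    have := hconn.card_le_ncard_edgeSet_add_one
    rw [edgeSet_colorGraph] at this
    omega)
  rwa [← Set.ncard_eq_toFinset_card _ hfin, hcard] at hbound

/-- Coloring `k` disjoint spanning trees with one color each, and the remaining edges with
pairwise distinct new colors. -/
lemma TauGE.exists_isRMCColoring [Finite V] [Nontrivial V] {k : ℕ} (h : G.TauGE k) :
    ∃ c, G.IsRMCColoring k c ∧
      G.edgeSet.ncard + k ≤ G.colorsUsed c + k * (Nat.card V - 1) := by
  classical
  obtain ⟨T, hTG, hT, hdisj⟩ := h
  obtain ⟨n, ⟨enc⟩⟩ := Finite.exists_equiv_fin (Sym2 V)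
  let c : Sym2 V → ℕ := fun e => if h : ∃ i, e ∈ (T i).edgeSet then h.choose else k + enc e
  have hcT : ∀ i, ∀ e ∈ (T i).edgeSet, c e = i := by
    intro i e he
    have hex : ∃ i, e ∈ (T i).edgeSet := ⟨i, he⟩
    simp only [c, dif_pos hex]
    by_contra hne
    exact Set.disjoint_left.1 (hdisj _ _ fun heq => hne (congrArg Fin.val heq))
      hex.choose_spec he
  let U : Set (Sym2 V) := ⋃ i, (T i).edgeSet
  have hcU : ∀ e ∉ U, c e = k + enc e := by
    intro e he
    exact dif_neg fun hex => he (Set.mem_iUnion.2 hex)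
  refine ⟨c, ?_, ?_⟩
  · intro u v _
    choose p hp using fun i => (hT i).connected.exists_isPath u v
    refine ⟨fun i => (p i).mapLe (hTG i), fun i => i, fun i => (hp i).mapLe (hTG i), ?_, ?_,
      Fin.val_injective⟩
    · intro i e he
      rw [Walk.edges_mapLe_eq_edges] at he
      exact hcT i e ((p i).edges_subset_edgeSet he)
    · intro i j hij e hi hj
      rw [Walk.edges_mapLe_eq_edges] at hi hj
      exact Set.disjoint_left.1 (hdisj i j hij) ((p i).edges_subset_edgeSet hi)
        ((p j).edges_subset_edgeSet hj)
  · have hU : U.ncard ≤ k * (Nat.card V - 1) := by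
      refine (Set.ncard_iUnion_le_of_fintype _).trans ?_
      refine (Finset.sum_le_card_nsmul _ _ (Nat.card V - 1) fun i _ => ?_).trans_eq (by simp)
      have := (hT i).ncard_edgeSet_add_one
      omega
    have hsdiff : G.edgeSet.ncard ≤ (G.edgeSet \ U).ncard + U.ncard :=
      Set.ncard_le_ncard_sdiff_add_ncard _ _
    have hinj : (c '' (G.edgeSet \ U)).ncard = (G.edgeSet \ U).ncard := by
      refine Set.InjOn.ncard_image fun e he f hf hef => ?_
      rw [hcU e he.2, hcU f hf.2] at hef
      exact enc.injective (Fin.val_injective (by omega))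
    have hlow : Set.range (Fin.val : Fin k → ℕ) ⊆ c '' G.edgeSet := by
      rintro _ ⟨i, rfl⟩
      obtain ⟨u⟩ := (inferInstance : Nonempty V)
      obtain ⟨w, hw⟩ := (hT i).connected.preconnected.exists_adj_of_nontrivial u
      exact ⟨s(u, w), hTG i hw, hcT i _ hw⟩
    have hd : Disjoint (Set.range (Fin.val : Fin k → ℕ)) (c '' (G.edgeSet \ U)) := by
      rw [Set.disjoint_left]
      rintro _ ⟨i, rfl⟩ ⟨e, he, hei⟩
      rw [hcU e he.2] at hei
      omega
    have hle : (Set.range (Fin.val : Fin k → ℕ) ∪ c '' (G.edgeSet \ U)).ncard ≤ G.colorsUsed c :=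
      Set.ncard_le_ncard (Set.union_subset hlow (Set.image_mono Set.sdiff_subset))
        (Set.toFinite _)
    rw [Set.ncard_union_eq hd (Set.toFinite _) (Set.toFinite _), hinj, ← Set.image_univ,
      Set.ncard_image_of_injective _ Fin.val_injective, Set.ncard_univ, Nat.card_fin] at hle
    omega

end SimpleGraph

/-- If `τ(G) ≥ k ≥ 2` and `G` is not `(k+1)`-edge-connected, i.e. `G` has an
edge cut of size at most `k`, then `rmc_k(G) = m - k(n-2)`. -/
theorem rmc_eq_of_not_edgeConnected {V : Type*} [Fintype V] (G : SimpleGraph V) (k : ℕ)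
    (hk : 2 ≤ k) (htau : G.TauGE k)
    (hcut : ∃ S : Set (Sym2 V), S ⊆ G.edgeSet ∧ S.ncard ≤ k ∧
      ¬ (G.deleteEdges S).Connected) :
    G.rmc k = G.edgeSet.ncard - k * (Fintype.card V - 2) := by
  have hne : Nonempty V := (htau.elim fun T hT => (hT.2.1 ⟨0, by omega⟩).connected.nonempty)
  obtain ⟨S, -, hS, hnc⟩ := hcut
  obtain ⟨u, v, huv⟩ : ∃ u v, ¬ (G.deleteEdges S).Reachable u v := by
    by_contra! hall
    exact hnc ⟨hall⟩
  have : Nontrivial V := ⟨u, v, fun h => huv (h ▸ Reachable.refl _)⟩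
  have hV : 2 ≤ Nat.card V := Finite.one_lt_card
  obtain ⟨r, hr⟩ := Nat.exists_eq_add_of_le' hV
  have hmul : k * (Nat.card V - 1) = k * (Nat.card V - 2) + k := by
    rw [hr, ← Nat.mul_succ]
    congr 1
  rw [← Nat.card_eq_fintype_card]
  have hupper : ∀ c, G.IsRMCColoring k c →
      G.colorsUsed c ≤ G.edgeSet.ncard - k * (Nat.card V - 2) := fun c hc => by
    have := hc.colorsUsed_add_le_s13 hS huv
    omega
  obtain ⟨c, hc, hlower⟩ := htau.exists_isRMCColoring
  refine IsGreatest.csSup_eq ⟨⟨c, hc, (hupper c hc).antisymm (by omega)⟩, ?_⟩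
  rintro _ ⟨c', hc', rfl⟩
  exact hupper c' hc'
end
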